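/- arXiv:1202.6353 — 2 statements merged into one kernel-verified Lean document; each statement's English description precedes it below -/
import Mathlib

section
/- In the residual Selmer setting, assume hypothesis (DU1). Then for every finite subset n ⊆ L and every ℓ ∈ L∖n: ρ(n∪{ℓ}) = ρ(n) + 1 if u_ℓ vanishes identically on Sel(n), and ρ(n∪{ℓ}) = ρ(n) − 1 otherwise. -/
/-- The Selmer subspace attached to a finite subset `n ⊆ L`: vectors killed by `o ℓ`
for all `ℓ ∉ n` and by `u ℓ` for all `ℓ ∈ n`. -/
def resSel {K V L : Type*} [Field K] [AddCommGroup V] [Module K V]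
    (u o : L → (V →ₗ[K] K)) (n : Finset L) : Submodule K V :=
  (⨅ (ℓ : L) (_ : ℓ ∉ n), LinearMap.ker (o ℓ)) ⊓ (⨅ ℓ ∈ n, LinearMap.ker (u ℓ))

/-- Intersecting a finite-dimensional subspace with the kernel of a functional that is nonzero
on it lowers the dimension by one. -/
theorem Submodule.finrank_inf_ker_add_one {K V : Type*} [Field K] [AddCommGroup V] [Module K V]
    (S : Submodule K V) [FiniteDimensional K S] (f : V →ₗ[K] K) (hf : ∃ x ∈ S, f x ≠ 0) :
    Module.finrank K (S ⊓ LinearMap.ker f : Submodule K V) + 1 = Module.finrank K S := by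
  obtain ⟨x, hx, hfx⟩ := hf
  have hne : f.domRestrict S ≠ 0 := fun h => hfx (by simpa using LinearMap.congr_fun h ⟨x, hx⟩)
  have hker : LinearMap.ker (f.domRestrict S) = (S ⊓ LinearMap.ker f).comap S.subtype := by
    ext; simp
  rw [← Module.Dual.finrank_ker_add_one_of_ne_zero hne, hker,
    (Submodule.comapSubtypeEquivOfLe inf_le_left).finrank_eq]

theorem Submodule.inf_ker_eq_left {K V : Type*} [Field K] [AddCommGroup V] [Module K V]
    (S : Submodule K V) (f : V →ₗ[K] K) (hf : ∀ x ∈ S, f x = 0) :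
    S ⊓ LinearMap.ker f = S :=
  inf_eq_left.2 fun x hx => hf x hx

theorem mem_resSel {K V L : Type*} [Field K] [AddCommGroup V] [Module K V]
    {u o : L → (V →ₗ[K] K)} {n : Finset L} {x : V} :
    x ∈ resSel u o n ↔ (∀ m ∉ n, o m x = 0) ∧ ∀ m ∈ n, u m x = 0 := by
  simp [resSel]

theorem resSel_inf_ker_eq_resSel_insert_inf_ker {K V L : Type*} [Field K] [AddCommGroup V]
    [Module K V] [DecidableEq L] (u o : L → (V →ₗ[K] K)) {n : Finset L} {ℓ : L} (hℓ : ℓ ∉ n) :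
    resSel u o n ⊓ LinearMap.ker (u ℓ) = resSel u o (insert ℓ n) ⊓ LinearMap.ker (o ℓ) := by
  ext x
  simp only [Submodule.mem_inf, mem_resSel, LinearMap.mem_ker, Finset.mem_insert]
  grind

/-- In the residual Selmer setting, under (DU1): `ρ(n∪{ℓ}) = ρ(n) + 1` if `u_ℓ` vanishes
on `Sel(n)`, and `ρ(n∪{ℓ}) = ρ(n) − 1` otherwise. -/
theorem resSel_rank_change
    {K V L : Type*} [Field K] [AddCommGroup V] [Module K V] [Infinite L] [DecidableEq L]
    (u o : L → (V →ₗ[K] K))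
    (hfin : ∀ n : Finset L, FiniteDimensional K (resSel u o n))
    -- (DU1)
    (hDU1 : ∀ (n : Finset L) (ℓ : L), ℓ ∉ n →
      Xor' (∃ x ∈ resSel u o n, u ℓ x ≠ 0)
           (∃ x ∈ resSel u o (insert ℓ n), o ℓ x ≠ 0)) :
    ∀ (n : Finset L) (ℓ : L), ℓ ∉ n →
      ((∀ x ∈ resSel u o n, u ℓ x = 0) →
        Module.finrank K (resSel u o (insert ℓ n)) =
          Module.finrank K (resSel u o n) + 1) ∧
      ((¬ ∀ x ∈ resSel u o n, u ℓ x = 0) →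
        Module.finrank K (resSel u o (insert ℓ n)) + 1 =
          Module.finrank K (resSel u o n)) := by
  intro n ℓ hℓ
  have := hfin n
  have := hfin (insert ℓ n)
  have hinf := resSel_inf_ker_eq_resSel_insert_inf_ker u o hℓ
  refine ⟨fun hu => ?_, fun hu => ?_⟩
  · have ho : ∃ x ∈ resSel u o (insert ℓ n), o ℓ x ≠ 0 :=
      (hDU1 n ℓ hℓ).elim (fun h => absurd h.1 (by simpa using hu)) And.left
    rw [← Submodule.finrank_inf_ker_add_one _ _ ho, ← hinf, Submodule.inf_ker_eq_left _ _ hu]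
  · push Not at hu
    have ho : ∀ x ∈ resSel u o (insert ℓ n), o ℓ x = 0 := by
      have h := (hDU1 n ℓ hℓ).elim And.right (fun h => absurd hu h.2)
      push Not at h
      exact h
    rw [← Submodule.finrank_inf_ker_add_one _ _ hu, hinf, Submodule.inf_ker_eq_left _ _ ho]
end

section
/- In the residual Selmer setting, assume hypotheses (DU1) and (LS1). Let a be a finite subset of L with ρ(a) ≤ 1. Then the graph whose vertices are the finite subsets n ⊆ L with a ⊆ n and ρ(n) ≤ 1, with an edge between n and n∪{ℓ} (ℓ ∈ L∖n) whenever both are vertices, is path-connected. -/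
/-- Two finite subsets of `L` are adjacent if one is obtained from the other by
inserting a single new element of `L`. -/
def resAdj {L : Type*} [DecidableEq L] (n n' : Finset L) : Prop :=
  (∃ ℓ ∉ n, n' = insert ℓ n) ∨ (∃ ℓ ∉ n', n = insert ℓ n')

open scoped symmDiff

/-- A reflexive-transitive chain of steps can be listed as a sequence. -/
theorem Relation.ReflTransGen.exists_seq {α : Type*} {R : α → α → Prop} {x y : α}
    (h : Relation.ReflTransGen R x y) :
    ∃ (r : ℕ) (c : ℕ → α), c 0 = x ∧ c r = y ∧ ∀ i < r, R (c i) (c (i + 1)) := by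
  induction h using Relation.ReflTransGen.head_induction_on with
  | refl => exact ⟨0, fun _ => y, rfl, rfl, by simp⟩
  | @head x z hxz _ ih =>
    obtain ⟨r, c, h0, hr, hc⟩ := ih
    refine ⟨r + 1, fun i => i.casesOn x c, rfl, hr, ?_⟩
    rintro (_ | i) hi
    · simpa [h0] using hxz
    · exact hc i (by omega)

/-- The functional that vanishes on `resSel u o n` at the index `ℓ`. -/
def resLocal {K V L : Type*} [Field K] [AddCommGroup V] [Module K V] [DecidableEq L]
    (u o : L → (V →ₗ[K] K)) (n : Finset L) (ℓ : L) : V →ₗ[K] K :=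
  if ℓ ∈ n then u ℓ else o ℓ

theorem finrank_resSel_le_one_of_eq_bot
    {K V L : Type*} [Field K] [AddCommGroup V] [Module K V]
    {u o : L → (V →ₗ[K] K)} {n : Finset L} (hn : resSel u o n = ⊥) :
    Module.finrank K (resSel u o n) ≤ 1 := by
  rw [hn, finrank_bot]
  exact zero_le_one

section

variable {K V L : Type*} [Field K] [AddCommGroup V] [Module K V] [DecidableEq L]
  {u o : L → (V →ₗ[K] K)}

theorem mem_resSel_iff {n : Finset L} {x : V} :
    x ∈ resSel u o n ↔ ∀ ℓ, resLocal u o n ℓ x = 0 := by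
  simp only [resSel, resLocal, Submodule.mem_inf, Submodule.mem_iInf, LinearMap.mem_ker]
  grind

theorem resLocal_congr {m n : Finset L} {ℓ : L} (h : ℓ ∈ m ↔ ℓ ∈ n) :
    resLocal u o m ℓ = resLocal u o n ℓ := by
  simp only [resLocal, h]

theorem mem_resSel_of_mem_symmDiff_singleton {n : Finset L} {e : L} {x : V}
    (hx : x ∈ resSel u o (n ∆ {e})) (he : resLocal u o n e x = 0) : x ∈ resSel u o n := by
  rw [mem_resSel_iff] at hx ⊢
  intro k
  by_cases hk : k = e
  · rwa [hk]
  · rw [← resLocal_congr (m := n ∆ {e}) (by simp [Finset.mem_symmDiff, hk])]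
    exact hx k

theorem resAdj_symmDiff_singleton (n : Finset L) (e : L) : resAdj n (n ∆ {e}) := by
  by_cases h : e ∈ n
  · exact Or.inr ⟨e, by simp [Finset.mem_symmDiff, h], by ext; grind [Finset.mem_symmDiff]⟩
  · exact Or.inl ⟨e, h, by ext; grind [Finset.mem_symmDiff]⟩

/-- Toggling one index changes exactly one of the two Selmer spaces: the toggle-invariant
form of (DU1). -/
theorem xor_resLocal_symmDiff_singleton
    (hDU1 : ∀ (n : Finset L) (ℓ : L), ℓ ∉ n →
      Xor (∃ x ∈ resSel u o n, u ℓ x ≠ 0) (∃ x ∈ resSel u o (insert ℓ n), o ℓ x ≠ 0))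
    (n : Finset L) (e : L) :
    Xor (∃ x ∈ resSel u o n, resLocal u o (n ∆ {e}) e x ≠ 0)
      (∃ x ∈ resSel u o (n ∆ {e}), resLocal u o n e x ≠ 0) := by
  by_cases h : e ∈ n
  · have h1 : n ∆ {e} = n.erase e := by ext; grind [Finset.mem_symmDiff]
    have h2 := hDU1 (n.erase e) e (by simp)
    rw [Finset.insert_erase h] at h2
    rw [xor_comm] at h2
    simpa [h1, resLocal, h] using h2
  · have h1 : n ∆ {e} = insert e n := by ext; grind [Finset.mem_symmDiff]
    simpa [h1, resLocal, h] using hDU1 n e h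

theorem finrank_resSel_symmDiff_singleton_le_one {n : Finset L} (hn : resSel u o n = ⊥) (e : L) :
    Module.finrank K (resSel u o (n ∆ {e})) ≤ 1 := by
  have hinj : Function.Injective ((resLocal u o n e).domRestrict (resSel u o (n ∆ {e}))) := by
    rw [injective_iff_map_eq_zero]
    rintro ⟨x, hx⟩ h
    have := mem_resSel_of_mem_symmDiff_singleton hx h
    simpa [hn] using this
  simpa using LinearMap.finrank_le_finrank_of_injective hinj

theorem resSel_symmDiff_singleton_eq_bot
    (hDU1 : ∀ (n : Finset L) (ℓ : L), ℓ ∉ n →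
      Xor (∃ x ∈ resSel u o n, u ℓ x ≠ 0) (∃ x ∈ resSel u o (insert ℓ n), o ℓ x ≠ 0))
    {m : Finset L} [FiniteDimensional K (resSel u o m)]
    (hm : Module.finrank K (resSel u o m) ≤ 1) {f : L} {x : V}
    (hx : x ∈ resSel u o m) (hxf : resLocal u o (m ∆ {f}) f x ≠ 0) :
    resSel u o (m ∆ {f}) = ⊥ := by
  rw [Submodule.eq_bot_iff]
  intro y hy
  have hyf : resLocal u o m f y = 0 := by
    by_contra hne
    rcases xor_resLocal_symmDiff_singleton hDU1 m f with h | h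
    · exact h.2 ⟨y, hy, hne⟩
    · exact h.2 ⟨x, hx, hxf⟩
  have hym := mem_resSel_of_mem_symmDiff_singleton hy hyf
  have hx0 : (⟨x, hx⟩ : resSel u o m) ≠ 0 := by
    intro h
    exact hxf (by rw [show x = 0 from congrArg Subtype.val h, map_zero])
  have hm1 : Module.finrank K (resSel u o m) = 1 :=
    le_antisymm hm (Module.finrank_pos_iff_exists_ne_zero.2 ⟨_, hx0⟩)
  obtain ⟨c, hc⟩ := exists_smul_eq_of_finrank_eq_one hm1 hx0 ⟨y, hym⟩
  have hc' : c • x = y := congrArg Subtype.val hc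
  have h0 := mem_resSel_iff.1 hy f
  rw [← hc', map_smul, smul_eq_mul, mul_eq_zero, or_iff_left hxf] at h0
  rw [← hc', h0, zero_smul]

/-- The symmetric exchange property of the finite subsets with trivial Selmer space. -/
theorem exists_resSel_exchange
    (hfin : ∀ n : Finset L, FiniteDimensional K (resSel u o n))
    (hDU1 : ∀ (n : Finset L) (ℓ : L), ℓ ∉ n →
      Xor (∃ x ∈ resSel u o n, u ℓ x ≠ 0) (∃ x ∈ resSel u o (insert ℓ n), o ℓ x ≠ 0))
    {n n' : Finset L} (hn : resSel u o n = ⊥) (hn' : resSel u o n' = ⊥) {e : L}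
    (he : e ∈ n ∆ n') :
    ∃ f ∈ n ∆ n', f ≠ e ∧ resSel u o ((n ∆ {e}) ∆ {f}) = ⊥ := by
  have := hfin
  obtain ⟨x, hx, hxe⟩ : ∃ x ∈ resSel u o (n ∆ {e}), resLocal u o n e x ≠ 0 := by
    rcases xor_resLocal_symmDiff_singleton hDU1 n e with ⟨⟨x, hx, h⟩, -⟩ | h
    · rw [hn, Submodule.mem_bot] at hx
      simp [hx] at h
    · exact h.1
  have hx0 : x ≠ 0 := fun h => hxe (by rw [h, map_zero])
  have hxn' : x ∉ resSel u o n' := by rwa [hn', Submodule.mem_bot]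
  rw [mem_resSel_iff] at hxn'
  push Not at hxn'
  obtain ⟨f, hf⟩ := hxn'
  have hdiff : ¬(f ∈ n ∆ {e} ↔ f ∈ n') := fun h =>
    hf (by rw [← resLocal_congr h]; exact mem_resSel_iff.1 hx f)
  refine ⟨f, by grind [Finset.mem_symmDiff], by grind [Finset.mem_symmDiff], ?_⟩
  refine resSel_symmDiff_singleton_eq_bot hDU1
    (finrank_resSel_symmDiff_singleton_le_one hn e) hx ?_
  rwa [resLocal_congr (n := n') (by grind [Finset.mem_symmDiff])]

theorem card_symmDiff_singleton_pair_lt {n n' : Finset L} {e f : L} (he : e ∈ n ∆ n')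
    (hf : f ∈ n ∆ n') (hfe : f ≠ e) :
    (((n ∆ {e}) ∆ {f}) ∆ n').card < (n ∆ n').card := by
  refine Finset.card_lt_card ⟨fun j hj => ?_, fun hsub => ?_⟩
  · grind [Finset.mem_symmDiff]
  · have := hsub he
    grind [Finset.mem_symmDiff]

/-- One step in the graph of core vertices containing `a`. -/
def coreStep (u o : L → (V →ₗ[K] K)) (a n n' : Finset L) : Prop :=
  (a ⊆ n ∧ Module.finrank K (resSel u o n) ≤ 1) ∧
    (a ⊆ n' ∧ Module.finrank K (resSel u o n') ≤ 1) ∧ resAdj n n'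

instance {a : Finset L} : Std.Symm (coreStep u o a) :=
  ⟨fun _ _ h => ⟨h.2.1, h.1, h.2.2.symm⟩⟩

theorem reflTransGen_coreStep_of_eq_bot
    (hfin : ∀ n : Finset L, FiniteDimensional K (resSel u o n))
    (hDU1 : ∀ (n : Finset L) (ℓ : L), ℓ ∉ n →
      Xor (∃ x ∈ resSel u o n, u ℓ x ≠ 0) (∃ x ∈ resSel u o (insert ℓ n), o ℓ x ≠ 0))
    {a n n' : Finset L} (han : a ⊆ n) (han' : a ⊆ n')
    (hn : resSel u o n = ⊥) (hn' : resSel u o n' = ⊥) :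
    Relation.ReflTransGen (coreStep u o a) n n' := by
  induction hk : (n ∆ n').card using Nat.strong_induction_on generalizing n with
  | _ k ih =>
  rcases (n ∆ n').eq_empty_or_nonempty with h | ⟨e, he⟩
  · rw [symmDiff_eq_bot.1 h]
  obtain ⟨f, hf, hfe, hbot⟩ := exists_resSel_exchange hfin hDU1 hn hn' he
  have hae : a ⊆ n ∆ {e} := by
    intro k hk
    grind [Finset.mem_symmDiff, han hk, han' hk]
  have haf : a ⊆ (n ∆ {e}) ∆ {f} := by
    intro k hk
    grind [Finset.mem_symmDiff, han hk, han' hk]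
  have hlt : (((n ∆ {e}) ∆ {f}) ∆ n').card < k :=
    hk ▸ card_symmDiff_singleton_pair_lt he hf hfe
  have hcore := finrank_resSel_symmDiff_singleton_le_one hn e
  refine .head (b := n ∆ {e}) ⟨⟨han, finrank_resSel_le_one_of_eq_bot hn⟩, ⟨hae, hcore⟩,
    resAdj_symmDiff_singleton _ _⟩ ?_
  exact .head ⟨⟨hae, hcore⟩, ⟨haf, finrank_resSel_le_one_of_eq_bot hbot⟩,
    resAdj_symmDiff_singleton _ _⟩ (ih _ hlt haf hbot rfl)

theorem exists_reflTransGen_coreStep_eq_bot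
    (hfin : ∀ n : Finset L, FiniteDimensional K (resSel u o n))
    (hDU1 : ∀ (n : Finset L) (ℓ : L), ℓ ∉ n →
      Xor (∃ x ∈ resSel u o n, u ℓ x ≠ 0) (∃ x ∈ resSel u o (insert ℓ n), o ℓ x ≠ 0))
    (hLS1 : ∀ (n : Finset L), ∀ x ∈ resSel u o n, x ≠ 0 → ∃ ℓ : L, ℓ ∉ n ∧ u ℓ x ≠ 0)
    {a n : Finset L} (hn : a ⊆ n ∧ Module.finrank K (resSel u o n) ≤ 1) :
    ∃ m, a ⊆ m ∧ resSel u o m = ⊥ ∧ Relation.ReflTransGen (coreStep u o a) n m := by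
  have := hfin
  by_cases h : resSel u o n = ⊥
  · exact ⟨n, hn.1, h, .refl⟩
  obtain ⟨x, hx, hx0⟩ := Submodule.exists_mem_ne_zero_of_ne_bot h
  obtain ⟨ℓ, hℓ, hxℓ⟩ := hLS1 n x hx hx0
  have hbot : resSel u o (n ∆ {ℓ}) = ⊥ :=
    resSel_symmDiff_singleton_eq_bot hDU1 hn.2 hx
      (by simpa [resLocal, Finset.mem_symmDiff, hℓ] using hxℓ)
  have ham : a ⊆ n ∆ {ℓ} := by
    intro k hk
    grind [Finset.mem_symmDiff, hn.1 hk]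
  exact ⟨n ∆ {ℓ}, ham, hbot,
    .single ⟨hn, ⟨ham, finrank_resSel_le_one_of_eq_bot hbot⟩, resAdj_symmDiff_singleton _ _⟩⟩

end

/-- In the residual Selmer setting, under (DU1) and (LS1): for a finite `a ⊆ L` with
`ρ(a) ≤ 1`, the graph of finite subsets `n ⊇ a` with `ρ(n) ≤ 1` (edges given by
insertion of one element) is path-connected. -/
theorem resSel_core_subgraph_connected
    {K V L : Type*} [Field K] [AddCommGroup V] [Module K V] [Infinite L] [DecidableEq L]
    (u o : L → (V →ₗ[K] K))
    (hfin : ∀ n : Finset L, FiniteDimensional K (resSel u o n))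
    -- (DU1)
    (hDU1 : ∀ (n : Finset L) (ℓ : L), ℓ ∉ n →
      Xor' (∃ x ∈ resSel u o n, u ℓ x ≠ 0)
           (∃ x ∈ resSel u o (insert ℓ n), o ℓ x ≠ 0))
    -- (LS1)
    (hLS1 : ∀ (n : Finset L), ∀ x ∈ resSel u o n, x ≠ 0 →
      ∃ ℓ : L, ℓ ∉ n ∧ u ℓ x ≠ 0)
    (a : Finset L) (ha : Module.finrank K (resSel u o a) ≤ 1) :
    ∀ n n' : Finset L,
      (a ⊆ n ∧ Module.finrank K (resSel u o n) ≤ 1) →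
      (a ⊆ n' ∧ Module.finrank K (resSel u o n') ≤ 1) →
      ∃ (r : ℕ) (c : Fin (r + 1) → Finset L),
        c 0 = n ∧ c (Fin.last r) = n' ∧
        (∀ i : Fin (r + 1),
          a ⊆ c i ∧ Module.finrank K (resSel u o (c i)) ≤ 1) ∧
        (∀ i : Fin r, resAdj (c i.castSucc) (c i.succ)) := by
  intro n n' hn hn'
  obtain ⟨m, ham, hm, hnm⟩ := exists_reflTransGen_coreStep_eq_bot hfin hDU1 hLS1 hn
  obtain ⟨m', ham', hm', hnm'⟩ := exists_reflTransGen_coreStep_eq_bot hfin hDU1 hLS1 hn'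
  have hpath : Relation.ReflTransGen (coreStep u o a) n n' :=
    (hnm.trans (reflTransGen_coreStep_of_eq_bot hfin hDU1 ham ham' hm hm')).trans
      (symm_of _ hnm')
  obtain ⟨r, c, h0, hr, hc⟩ := hpath.exists_seq
  refine ⟨r, fun i => c i, h0, hr, ?_, fun i => (hc i i.2).2.2⟩
  rintro ⟨_ | i, hi⟩
  · subst h0
    exact hn
  · exact (hc i (by omega)).2.1
end
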